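/- arXiv:1810.04232 — 2 statements merged into one kernel-verified Lean document; each statement's English description precedes it below -/
import Mathlib

section
/- Let k ≥ 0 be an integer and assume f(0) ∈ ℝ, f^{(j)}(0) = 0 for j = 1,…,2k, and c := f^{(2k+1)}(0)/(2k+1)! ∈ ℝ. Then there exist δ′ ∈ (0, δ²) and C > 0 such that for all real x with |x| < δ′, | S(x) − (−1)^{k+1}·(2c/(2k+3))·max(−x, 0)^{(2k+3)/2} | ≤ C·|x|^{k+2}. Thus at a caustic corresponding to a root of multiplicity 2k+1, the action function vanishes to the exact order (−x)^{k+3/2}. -/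
/-- The principal complex square root of a real number: `√t` for `t ≥ 0` and
`i·√(−t)` for `t < 0`. -/
noncomputable def sqrtC (t : ℝ) : ℂ :=
  if 0 ≤ t then (Real.sqrt t : ℂ) else Complex.I * (Real.sqrt (-t) : ℂ)

open Filter Topology

theorem sqrtC_eq_add (t : ℝ) :
    sqrtC t = (Real.sqrt t : ℂ) + Complex.I * (Real.sqrt (-t) : ℂ) := by
  unfold sqrtC
  split_ifs with h
  · simp [Real.sqrt_eq_zero_of_nonpos (neg_nonpos.mpr h)]
  · simp [Real.sqrt_eq_zero_of_nonpos (not_le.mp h).le]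

theorem continuous_sqrtC : Continuous sqrtC := by
  rw [funext sqrtC_eq_add]
  fun_prop

theorem norm_sqrtC (t : ℝ) : ‖sqrtC t‖ = Real.sqrt |t| := by
  unfold sqrtC
  split_ifs with h
  · simp [abs_of_nonneg h, Real.sqrt_nonneg]
  · simp [abs_of_neg (not_le.mp h), Real.sqrt_nonneg]

theorem im_sqrtC_pow_odd (k : ℕ) (t : ℝ) :
    (sqrtC t ^ (2 * k + 1)).im = (-1) ^ k * max (-t) 0 ^ ((k : ℝ) + 1 / 2) := by
  unfold sqrtC
  split_ifs with h
  · have hk : (k : ℝ) + 1 / 2 ≠ 0 := by positivity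
    rw [max_eq_right (neg_nonpos.mpr h), Real.zero_rpow hk, ← Complex.ofReal_pow,
      Complex.ofReal_im, mul_zero]
  · have ht : 0 < -t := by linarith [not_le.mp h]
    have hI : (Complex.I * (Real.sqrt (-t) : ℂ)) ^ (2 * k + 1) =
        (((-1) ^ k * ((-t) ^ k * Real.sqrt (-t)) : ℝ) : ℂ) * Complex.I := by
      have hs : (Real.sqrt (-t) : ℂ) ^ 2 = ((-t : ℝ) : ℂ) := by
        rw [← Complex.ofReal_pow, Real.sq_sqrt ht.le]
      rw [mul_pow, pow_succ, pow_succ, pow_mul, pow_mul, hs, Complex.I_sq]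
      push_cast
      ring
    rw [hI, max_eq_left ht.le, Real.rpow_add ht, Real.rpow_natCast, ← Real.sqrt_eq_rpow,
      Complex.im_ofReal_mul, Complex.I_im, mul_one]

theorem integral_max_neg_rpow (k : ℕ) (x : ℝ) :
    ∫ t in (0 : ℝ)..x, max (-t) 0 ^ ((k : ℝ) + 1 / 2) =
      -(2 / (2 * (k : ℝ) + 3)) * max (-x) 0 ^ ((2 * (k : ℝ) + 3) / 2) := by
  have hk : (k : ℝ) + 1 / 2 ≠ 0 := by positivity
  have hk' : (2 * (k : ℝ) + 3) / 2 ≠ 0 := by positivity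
  rcases le_total 0 x with hx | hx
  · rw [max_eq_right (neg_nonpos.mpr hx), Real.zero_rpow hk', mul_zero]
    refine (intervalIntegral.integral_congr (g := fun _ => (0 : ℝ)) fun t ht => ?_).trans (by simp)
    rw [Set.uIcc_of_le hx] at ht
    simp only [max_eq_right (neg_nonpos.mpr ht.1), Real.zero_rpow hk]
  · rw [max_eq_left (neg_nonneg.mpr hx)]
    have hcongr : ∫ t in (0 : ℝ)..x, max (-t) 0 ^ ((k : ℝ) + 1 / 2) =
        ∫ t in (0 : ℝ)..x, (-t) ^ ((k : ℝ) + 1 / 2) := by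
      refine intervalIntegral.integral_congr fun t ht => ?_
      rw [Set.uIcc_of_ge hx] at ht
      simp only [max_eq_left (neg_nonneg.mpr ht.2)]
    have he : (k : ℝ) + 1 / 2 + 1 = (2 * (k : ℝ) + 3) / 2 := by ring
    rw [hcongr, intervalIntegral.integral_comp_neg (fun t : ℝ => t ^ ((k : ℝ) + 1 / 2)),
      integral_rpow (Or.inl (by linarith [(Nat.cast_nonneg k : (0 : ℝ) ≤ k)])), he, neg_zero,
      Real.zero_rpow hk']
    field_simp
    ring

theorem isBigO_sub_taylor_of_iteratedDeriv_eq_zero {f : ℂ → ℂ} (hf : AnalyticAt ℂ f 0) (n : ℕ)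
    (hvanish : ∀ j : ℕ, 1 ≤ j → j ≤ n → iteratedDeriv j f 0 = 0) :
    (fun z => f z - (f 0 + iteratedDeriv (n + 1) f 0 / ((n + 1).factorial : ℂ) * z ^ (n + 1)))
      =O[𝓝 0] fun z => ‖z‖ ^ (n + 2) := by
  refine (hf.hasFPowerSeriesAt.isBigO_sub_partialSum_pow (n + 2)).congr_left fun z => ?_
  have hzero : ∑ j ∈ Finset.range n,
      z ^ (j + 1) * (iteratedDeriv (j + 1) f 0 / ((j + 1).factorial : ℂ)) = 0 := by
    refine Finset.sum_eq_zero fun j hj => ?_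
    rw [hvanish (j + 1) (by lia) (by have := Finset.mem_range.mp hj; lia)]
    simp
  simp only [FormalMultilinearSeries.partialSum, FormalMultilinearSeries.apply_eq_pow_smul_coeff,
    FormalMultilinearSeries.coeff_ofScalars, smul_eq_mul, zero_add]
  rw [Finset.sum_range_succ, Finset.sum_range_succ', hzero]
  simp
  ring

/-- One-dimensional model of the action function at a higher-multiplicity caustic.
Let `f` be holomorphic on the disc of radius `δ` with `f(0) ∈ ℝ`, `f^{(j)}(0) = 0` for
`j = 1,…,2k`, and `c := f^{(2k+1)}(0)/(2k+1)! ∈ ℝ`, and let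
`S(x) = Im ∫₀ˣ f(√t) dt` for `|x| < δ²`.  Then there are `δ′ ∈ (0, δ²)` and `C > 0`
such that for all `|x| < δ′`,
`| S(x) − (−1)^{k+1}·(2c/(2k+3))·max(−x,0)^{(2k+3)/2} | ≤ C·|x|^{k+2}`. -/
theorem action_function_higher_multiplicity
    (δ : ℝ) (hδ : 0 < δ) (f : ℂ → ℂ)
    (hf : DifferentiableOn ℂ f (Metric.ball 0 δ))
    (k : ℕ)
    (hf0 : (f 0).im = 0)
    (hvanish : ∀ j : ℕ, 1 ≤ j → j ≤ 2 * k → iteratedDeriv j f 0 = 0)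
    (c : ℝ) (hc : iteratedDeriv (2 * k + 1) f 0 = (((2 * k + 1).factorial : ℂ)) * (c : ℂ))
    (S : ℝ → ℝ)
    (hS : ∀ x : ℝ, |x| < δ ^ 2 → S x = (∫ t in (0:ℝ)..x, f (sqrtC t)).im) :
    ∃ δ' : ℝ, 0 < δ' ∧ δ' < δ ^ 2 ∧ ∃ C > (0 : ℝ), ∀ x : ℝ, |x| < δ' →
      |S x - (-1 : ℝ) ^ (k + 1) * (2 * c / (2 * (k : ℝ) + 3)) *
        max (-x) 0 ^ ((2 * (k : ℝ) + 3) / 2)| ≤ C * |x| ^ (k + 2) := by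
  have hball : Metric.ball (0 : ℂ) δ ∈ 𝓝 0 := Metric.ball_mem_nhds 0 hδ
  have hO := isBigO_sub_taylor_of_iteratedDeriv_eq_zero (hf.analyticAt hball) (2 * k) hvanish
  rw [hc, mul_div_cancel_left₀ _ (Nat.cast_ne_zero.mpr (Nat.factorial_ne_zero _))] at hO
  obtain ⟨C, hC, hO⟩ := hO.exists_pos
  obtain ⟨ε, hε, hbound⟩ := Metric.eventually_nhds_iff.mp hO.bound
  set r := min ε δ with hr
  have hr0 : 0 < r := lt_min hε hδ
  have hsmall : ∀ t : ℝ, |t| < r ^ 2 → ‖sqrtC t‖ < r := fun t ht => by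
    rw [norm_sqrtC, ← Real.sqrt_sq hr0.le]
    exact Real.sqrt_lt_sqrt (abs_nonneg t) ht
  have hrδ : r ^ 2 ≤ δ ^ 2 := by gcongr; exact min_le_right _ _
  refine ⟨r ^ 2 / 2, by positivity, by nlinarith [pow_pos hr0 2], C, hC, fun x hx => ?_⟩
  have hxr : |x| < r ^ 2 := by linarith [pow_pos hr0 2]
  have habs : ∀ t ∈ Set.uIcc 0 x, |t| ≤ |x| := fun t ht => by
    simpa using Set.abs_sub_left_of_mem_uIcc ht
  have hcont : ContinuousOn (fun t => f (sqrtC t)) (Set.uIcc 0 x) := by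
    refine hf.continuousOn.comp continuous_sqrtC.continuousOn fun t ht => ?_
    rw [mem_ball_zero_iff]
    exact (hsmall t ((habs t ht).trans_lt hxr)).trans_le (min_le_right _ _)
  have hcont' : Continuous fun t => f 0 + (c : ℂ) * sqrtC t ^ (2 * k + 1) :=
    continuous_const.add (continuous_const.mul (continuous_sqrtC.pow _))
  have him : ∀ t, (f 0 + (c : ℂ) * sqrtC t ^ (2 * k + 1)).im =
      c * (-1) ^ k * max (-t) 0 ^ ((k : ℝ) + 1 / 2) := fun t => by
    rw [Complex.add_im, hf0, Complex.im_ofReal_mul, im_sqrtC_pow_odd]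
    ring
  have hmain : (∫ t in (0 : ℝ)..x, (f 0 + (c : ℂ) * sqrtC t ^ (2 * k + 1))).im =
      (-1 : ℝ) ^ (k + 1) * (2 * c / (2 * (k : ℝ) + 3)) *
        max (-x) 0 ^ ((2 * (k : ℝ) + 3) / 2) := by
    have hcomm := Complex.imCLM.intervalIntegral_comp_comm
      (hcont'.intervalIntegrable (μ := MeasureTheory.volume) 0 x)
    simp only [Complex.imCLM_apply, him] at hcomm
    rw [← hcomm, intervalIntegral.integral_const_mul, integral_max_neg_rpow]
    ring
  rw [hS x (hxr.trans_le hrδ), ← hmain, ← Complex.sub_im,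
    ← intervalIntegral.integral_sub hcont.intervalIntegrable (hcont'.intervalIntegrable 0 x)]
  refine (Complex.abs_im_le_norm _).trans ?_
  refine (intervalIntegral.norm_integral_le_of_norm_le_const (C := C * |x| ^ (k + 1))
    fun t ht => ?_).trans_eq (by rw [sub_zero]; ring)
  have htx := habs t (Set.uIoc_subset_uIcc ht)
  have hlt : ‖sqrtC t‖ < ε := (hsmall t (htx.trans_lt hxr)).trans_le (min_le_left _ _)
  have hpow : ‖sqrtC t‖ ^ (2 * k + 2) = |t| ^ (k + 1) := by
    rw [norm_sqrtC, show 2 * k + 2 = 2 * (k + 1) by ring, pow_mul, Real.sq_sqrt (abs_nonneg t)]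
  have hb := hbound (by rwa [dist_zero_right] : dist (sqrtC t) 0 < ε)
  rw [norm_pow, norm_norm, hpow] at hb
  exact hb.trans (by gcongr)
end

section
/- For every h > 0 and every smooth function u : ℝ² → ℂ, the semiclassical Liouville oscillator Q₁ and its quantum integral Q₂ commute: Q₁(Q₂ u) = Q₂(Q₁ u), where Q₁u = −(a(x₁)+b(x₂))^{−1}·h²·(∂²u/∂x₁² + ∂²u/∂x₂²) + (b(x₂) − a(x₁))·u and Q₂u = −(a(x₁)+b(x₂))^{−1}·h²·(b(x₂)·∂²u/∂x₁² − a(x₁)·∂²u/∂x₂²) − a(x₁)·b(x₂)·u. -/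
/-- Second partial derivative in the first variable of `u : ℝ² → ℂ`. -/
noncomputable def dxx (u : ℝ × ℝ → ℂ) : ℝ × ℝ → ℂ :=
  fun p => deriv (fun s => deriv (fun s' => u (s', p.2)) s) p.1

/-- Second partial derivative in the second variable of `u : ℝ² → ℂ`. -/
noncomputable def dyy (u : ℝ × ℝ → ℂ) : ℝ × ℝ → ℂ :=
  fun p => deriv (fun t => deriv (fun t' => u (p.1, t')) t) p.2

/-- The semiclassical Liouville oscillator
`Q₁u = −(a(x₁)+b(x₂))⁻¹·h²·(∂²u/∂x₁² + ∂²u/∂x₂²) + (b(x₂) − a(x₁))·u`. -/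
noncomputable def LiouvilleQ1 (a b : ℝ → ℝ) (h : ℝ) (u : ℝ × ℝ → ℂ) : ℝ × ℝ → ℂ :=
  fun p => -((a p.1 + b p.2 : ℝ) : ℂ)⁻¹ * (h : ℂ) ^ 2 * (dxx u p + dyy u p) +
    ((b p.2 - a p.1 : ℝ) : ℂ) * u p

/-- The quantum integral of the Liouville oscillator
`Q₂u = −(a(x₁)+b(x₂))⁻¹·h²·(b(x₂)·∂²u/∂x₁² − a(x₁)·∂²u/∂x₂²) − a(x₁)·b(x₂)·u`. -/
noncomputable def LiouvilleQ2 (a b : ℝ → ℝ) (h : ℝ) (u : ℝ × ℝ → ℂ) : ℝ × ℝ → ℂ :=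
  fun p => -((a p.1 + b p.2 : ℝ) : ℂ)⁻¹ * (h : ℂ) ^ 2 *
    ((b p.2 : ℂ) * dxx u p - (a p.1 : ℂ) * dyy u p) - ((a p.1 * b p.2 : ℝ) : ℂ) * u p

open scoped ContDiff

/-- The derivative of a smooth function in a fixed direction is smooth. -/
lemma ContDiff.fderiv_apply_const {E F : Type*} [NormedAddCommGroup E] [NormedSpace ℝ E]
    [NormedAddCommGroup F] [NormedSpace ℝ F] {u : E → F} (hu : ContDiff ℝ ∞ u) (v : E) :
    ContDiff ℝ ∞ (fun p => fderiv ℝ u p v) :=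
  (hu.fderiv_right (m := ∞) le_rfl).clm_apply contDiff_const

/-- Derivatives of a smooth function in two fixed directions commute. -/
lemma ContDiff.fderiv_fderiv_comm {E F : Type*} [NormedAddCommGroup E] [NormedSpace ℝ E]
    [NormedAddCommGroup F] [NormedSpace ℝ F] {u : E → F} (hu : ContDiff ℝ ∞ u) (v w : E) :
    (fun p => fderiv ℝ (fun q => fderiv ℝ u q v) p w) =
      fun p => fderiv ℝ (fun q => fderiv ℝ u q w) p v := by
  funext p
  have hd : DifferentiableAt ℝ (fderiv ℝ u) p :=
    (hu.fderiv_right (m := ∞) le_rfl).differentiable (by simp) p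
  have hs : IsSymmSndFDerivAt ℝ u p :=
    hu.contDiffAt.isSymmSndFDerivAt (by simpa using WithTop.coe_le_coe.2 (le_top : (2 : ℕ∞) ≤ ⊤))
  rw [fderiv_clm_apply hd (differentiableAt_const _), fderiv_clm_apply hd (differentiableAt_const _)]
  simpa using hs.eq w v

lemma ContDiff.fderiv_sub_apply {E F : Type*} [NormedAddCommGroup E] [NormedSpace ℝ E]
    [NormedAddCommGroup F] [NormedSpace ℝ F] {f g : E → F} (hf : ContDiff ℝ ∞ f)
    (hg : ContDiff ℝ ∞ g) (p v : E) :
    fderiv ℝ (fun q => f q - g q) p v = fderiv ℝ f p v - fderiv ℝ g p v := by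
  rw [fderiv_fun_sub (hf.differentiable (by simp) p) (hg.differentiable (by simp) p)]
  rfl

lemma deriv_fst_slice {u : ℝ × ℝ → ℂ} (hu : ContDiff ℝ ∞ u) (s t : ℝ) :
    deriv (fun s' => u (s', t)) s = fderiv ℝ u (s, t) (1, 0) := by
  have h₁ : HasDerivAt (fun s' : ℝ => (s', t)) ((1 : ℝ), (0 : ℝ)) s :=
    (hasDerivAt_id s).prodMk (hasDerivAt_const s t)
  exact ((hu.differentiable (by simp) (s, t)).hasFDerivAt.comp_hasDerivAt s h₁).deriv

lemma deriv_snd_slice {u : ℝ × ℝ → ℂ} (hu : ContDiff ℝ ∞ u) (s t : ℝ) :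
    deriv (fun t' => u (s, t')) t = fderiv ℝ u (s, t) (0, 1) := by
  have h₁ : HasDerivAt (fun t' : ℝ => (s, t')) ((0 : ℝ), (1 : ℝ)) t :=
    (hasDerivAt_const t s).prodMk (hasDerivAt_id t)
  exact ((hu.differentiable (by simp) (s, t)).hasFDerivAt.comp_hasDerivAt t h₁).deriv

lemma dxx_eq_fderiv {u : ℝ × ℝ → ℂ} (hu : ContDiff ℝ ∞ u) :
    dxx u = fun p => fderiv ℝ (fun q => fderiv ℝ u q (1, 0)) p (1, 0) := by
  funext p
  simp only [dxx, deriv_fst_slice hu]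
  exact deriv_fst_slice (hu.fderiv_apply_const (1, 0)) p.1 p.2

lemma dyy_eq_fderiv {u : ℝ × ℝ → ℂ} (hu : ContDiff ℝ ∞ u) :
    dyy u = fun p => fderiv ℝ (fun q => fderiv ℝ u q (0, 1)) p (0, 1) := by
  funext p
  simp only [dyy, deriv_snd_slice hu]
  exact deriv_snd_slice (hu.fderiv_apply_const (0, 1)) p.1 p.2

lemma contDiff_dxx {u : ℝ × ℝ → ℂ} (hu : ContDiff ℝ ∞ u) : ContDiff ℝ ∞ (dxx u) := by
  rw [dxx_eq_fderiv hu]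
  exact (hu.fderiv_apply_const _).fderiv_apply_const _

lemma contDiff_dyy {u : ℝ × ℝ → ℂ} (hu : ContDiff ℝ ∞ u) : ContDiff ℝ ∞ (dyy u) := by
  rw [dyy_eq_fderiv hu]
  exact (hu.fderiv_apply_const _).fderiv_apply_const _

lemma dxx_dyy_comm {u : ℝ × ℝ → ℂ} (hu : ContDiff ℝ ∞ u) : dxx (dyy u) = dyy (dxx u) := by
  rw [dxx_eq_fderiv (contDiff_dyy hu), dyy_eq_fderiv (contDiff_dxx hu),
    dyy_eq_fderiv hu, dxx_eq_fderiv hu]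
  rw [(hu.fderiv_apply_const (0, 1)).fderiv_fderiv_comm (0, 1) (1, 0),
    hu.fderiv_fderiv_comm (0, 1) (1, 0),
    ((hu.fderiv_apply_const (1, 0)).fderiv_apply_const (0, 1)).fderiv_fderiv_comm (0, 1) (1, 0),
    (hu.fderiv_apply_const (1, 0)).fderiv_fderiv_comm (0, 1) (1, 0)]

lemma dxx_sub {f g : ℝ × ℝ → ℂ} (hf : ContDiff ℝ ∞ f) (hg : ContDiff ℝ ∞ g) (p : ℝ × ℝ) :
    dxx (fun q => f q - g q) p = dxx f p - dxx g p := by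
  rw [dxx_eq_fderiv (hf.sub hg), dxx_eq_fderiv hf, dxx_eq_fderiv hg]
  simp only [hf.fderiv_sub_apply hg,
    (hf.fderiv_apply_const _).fderiv_sub_apply (hg.fderiv_apply_const _)]

lemma dyy_sub {f g : ℝ × ℝ → ℂ} (hf : ContDiff ℝ ∞ f) (hg : ContDiff ℝ ∞ g) (p : ℝ × ℝ) :
    dyy (fun q => f q - g q) p = dyy f p - dyy g p := by
  rw [dyy_eq_fderiv (hf.sub hg), dyy_eq_fderiv hf, dyy_eq_fderiv hg]
  simp only [hf.fderiv_sub_apply hg,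
    (hf.fderiv_apply_const _).fderiv_sub_apply (hg.fderiv_apply_const _)]

lemma dxx_snd_mul (c : ℝ → ℂ) (u : ℝ × ℝ → ℂ) (p : ℝ × ℝ) :
    dxx (fun q => c q.2 * u q) p = c p.2 * dxx u p := by
  simp only [dxx, deriv_const_mul_field]

lemma dyy_fst_mul (c : ℝ → ℂ) (u : ℝ × ℝ → ℂ) (p : ℝ × ℝ) :
    dyy (fun q => c q.1 * u q) p = c p.1 * dyy u p := by
  simp only [dyy, deriv_const_mul_field]

/-- The separated operator `-h²∂₁² - a(x₁)²`. -/
noncomputable def liouvilleX (a : ℝ → ℝ) (h : ℝ) (u : ℝ × ℝ → ℂ) : ℝ × ℝ → ℂ :=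
  fun p => -(h : ℂ) ^ 2 * dxx u p - (a p.1 : ℂ) ^ 2 * u p

/-- The separated operator `b(x₂)² - h²∂₂²`. -/
noncomputable def liouvilleY (b : ℝ → ℝ) (h : ℝ) (u : ℝ × ℝ → ℂ) : ℝ × ℝ → ℂ :=
  fun p => (b p.2 : ℂ) ^ 2 * u p - (h : ℂ) ^ 2 * dyy u p

lemma liouvilleX_sub (a : ℝ → ℝ) (h : ℝ) {f g : ℝ × ℝ → ℂ} (hf : ContDiff ℝ ∞ f)
    (hg : ContDiff ℝ ∞ g) (p : ℝ × ℝ) :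
    liouvilleX a h (fun q => f q - g q) p = liouvilleX a h f p - liouvilleX a h g p := by
  simp only [liouvilleX, dxx_sub hf hg]
  ring

lemma liouvilleY_sub (b : ℝ → ℝ) (h : ℝ) {f g : ℝ × ℝ → ℂ} (hf : ContDiff ℝ ∞ f)
    (hg : ContDiff ℝ ∞ g) (p : ℝ × ℝ) :
    liouvilleY b h (fun q => f q - g q) p = liouvilleY b h f p - liouvilleY b h g p := by
  simp only [liouvilleY, dyy_sub hf hg]
  ring

lemma liouvilleX_snd_mul (a : ℝ → ℝ) (h : ℝ) (c : ℝ → ℂ) (u : ℝ × ℝ → ℂ) (p : ℝ × ℝ) :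
    liouvilleX a h (fun q => c q.2 * u q) p = c p.2 * liouvilleX a h u p := by
  simp only [liouvilleX, dxx_snd_mul]
  ring

lemma liouvilleY_fst_mul (b : ℝ → ℝ) (h : ℝ) (c : ℝ → ℂ) (u : ℝ × ℝ → ℂ) (p : ℝ × ℝ) :
    liouvilleY b h (fun q => c q.1 * u q) p = c p.1 * liouvilleY b h u p := by
  simp only [liouvilleY, dyy_fst_mul]
  ring

lemma contDiff_ofReal_fst {a : ℝ → ℝ} (ha : ContDiff ℝ ∞ a) :
    ContDiff ℝ ∞ (fun p : ℝ × ℝ => (a p.1 : ℂ)) :=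
  Complex.ofRealCLM.contDiff.comp (ha.comp contDiff_fst)

lemma contDiff_ofReal_snd {b : ℝ → ℝ} (hb : ContDiff ℝ ∞ b) :
    ContDiff ℝ ∞ (fun p : ℝ × ℝ => (b p.2 : ℂ)) :=
  Complex.ofRealCLM.contDiff.comp (hb.comp contDiff_snd)

lemma liouvilleX_liouvilleY_comm {a b : ℝ → ℝ} (ha : ContDiff ℝ ∞ a) (hb : ContDiff ℝ ∞ b)
    (h : ℝ) {u : ℝ × ℝ → ℂ} (hu : ContDiff ℝ ∞ u) (p : ℝ × ℝ) :
    liouvilleX a h (liouvilleY b h u) p = liouvilleY b h (liouvilleX a h u) p := by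
  have hX : liouvilleX a h (liouvilleY b h u) p =
      (b p.2 : ℂ) ^ 2 * liouvilleX a h u p - (h : ℂ) ^ 2 * liouvilleX a h (dyy u) p := by
    rw [← liouvilleX_snd_mul a h (fun t => (b t : ℂ) ^ 2) u,
      ← liouvilleX_snd_mul a h (fun _ => (h : ℂ) ^ 2) (dyy u)]
    exact liouvilleX_sub a h (((contDiff_ofReal_snd hb).pow 2).mul hu)
      (contDiff_const.mul (contDiff_dyy hu)) p
  have hY : liouvilleY b h (liouvilleX a h u) p =
      -(h : ℂ) ^ 2 * liouvilleY b h (dxx u) p - (a p.1 : ℂ) ^ 2 * liouvilleY b h u p := by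
    rw [← liouvilleY_fst_mul b h (fun s => (a s : ℂ) ^ 2) u,
      ← liouvilleY_fst_mul b h (fun _ => -(h : ℂ) ^ 2) (dxx u)]
    exact liouvilleY_sub b h (contDiff_const.mul (contDiff_dxx hu))
      (((contDiff_ofReal_fst ha).pow 2).mul hu) p
  rw [hX, hY]
  simp only [liouvilleX, liouvilleY, dxx_dyy_comm hu]
  ring

lemma liouvilleX_eq {a b : ℝ → ℝ} (hpos : ∀ s t : ℝ, 0 < a s + b t) (h : ℝ)
    (u : ℝ × ℝ → ℂ) (p : ℝ × ℝ) :
    liouvilleX a h u p = (a p.1 : ℂ) * LiouvilleQ1 a b h u p + LiouvilleQ2 a b h u p := by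
  have hc : (a p.1 : ℂ) + b p.2 ≠ 0 := mod_cast (hpos p.1 p.2).ne'
  simp only [liouvilleX, LiouvilleQ1, LiouvilleQ2]
  push_cast
  field_simp
  ring

lemma liouvilleY_eq {a b : ℝ → ℝ} (hpos : ∀ s t : ℝ, 0 < a s + b t) (h : ℝ)
    (u : ℝ × ℝ → ℂ) (p : ℝ × ℝ) :
    liouvilleY b h u p = (b p.2 : ℂ) * LiouvilleQ1 a b h u p - LiouvilleQ2 a b h u p := by
  have hc : (a p.1 : ℂ) + b p.2 ≠ 0 := mod_cast (hpos p.1 p.2).ne'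
  simp only [liouvilleY, LiouvilleQ1, LiouvilleQ2]
  push_cast
  field_simp
  ring

lemma contDiff_inv_conformalFactor {a b : ℝ → ℝ} (hpos : ∀ s t : ℝ, 0 < a s + b t)
    (ha : ContDiff ℝ ∞ a) (hb : ContDiff ℝ ∞ b) :
    ContDiff ℝ ∞ (fun p : ℝ × ℝ => ((a p.1 + b p.2 : ℝ) : ℂ)⁻¹) := by
  refine ContDiff.inv ?_ fun p => mod_cast (hpos p.1 p.2).ne'
  exact Complex.ofRealCLM.contDiff.comp ((ha.comp contDiff_fst).add (hb.comp contDiff_snd))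

lemma contDiff_liouvilleQ1 {a b : ℝ → ℝ} (hpos : ∀ s t : ℝ, 0 < a s + b t) (h : ℝ)
    (ha : ContDiff ℝ ∞ a) (hb : ContDiff ℝ ∞ b)
    {u : ℝ × ℝ → ℂ} (hu : ContDiff ℝ ∞ u) : ContDiff ℝ ∞ (LiouvilleQ1 a b h u) := by
  refine ((((contDiff_inv_conformalFactor hpos ha hb).neg.mul contDiff_const).mul
    ((contDiff_dxx hu).add (contDiff_dyy hu)))).add (ContDiff.mul ?_ hu)
  exact Complex.ofRealCLM.contDiff.comp ((hb.comp contDiff_snd).sub (ha.comp contDiff_fst))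

lemma contDiff_liouvilleQ2 {a b : ℝ → ℝ} (hpos : ∀ s t : ℝ, 0 < a s + b t) (h : ℝ)
    (ha : ContDiff ℝ ∞ a) (hb : ContDiff ℝ ∞ b)
    {u : ℝ × ℝ → ℂ} (hu : ContDiff ℝ ∞ u) : ContDiff ℝ ∞ (LiouvilleQ2 a b h u) := by
  refine ((((contDiff_inv_conformalFactor hpos ha hb).neg.mul contDiff_const).mul
    (((contDiff_ofReal_snd hb).mul (contDiff_dxx hu)).sub
      ((contDiff_ofReal_fst ha).mul (contDiff_dyy hu))))).sub (ContDiff.mul ?_ hu)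
  exact Complex.ofRealCLM.contDiff.comp ((ha.comp contDiff_fst).mul (hb.comp contDiff_snd))

/-- Quantum complete integrability of the Liouville oscillator: for smooth `a, b` with
`a + b > 0`, any `h > 0` and any smooth `u : ℝ² → ℂ`, the operators `Q₁` and `Q₂`
commute: `Q₁(Q₂u) = Q₂(Q₁u)`. -/
theorem liouville_oscillator_commutes
    (a b : ℝ → ℝ) (ha : ContDiff ℝ (⊤ : ℕ∞) a) (hb : ContDiff ℝ (⊤ : ℕ∞) b)
    (hpos : ∀ s t : ℝ, 0 < a s + b t)
    (h : ℝ) (hh : 0 < h)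
    (u : ℝ × ℝ → ℂ) (hu : ContDiff ℝ (⊤ : ℕ∞) u) :
    LiouvilleQ1 a b h (LiouvilleQ2 a b h u) = LiouvilleQ2 a b h (LiouvilleQ1 a b h u) := by
  have h₁ := contDiff_liouvilleQ1 hpos h ha hb hu
  have h₂ := contDiff_liouvilleQ2 hpos h ha hb hu
  funext p
  have hc : (a p.1 : ℂ) + b p.2 ≠ 0 := mod_cast (hpos p.1 p.2).ne'
  have hXY : liouvilleX a h (liouvilleY b h u) p =
      (b p.2 : ℂ) * liouvilleX a h (LiouvilleQ1 a b h u) p -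
        liouvilleX a h (LiouvilleQ2 a b h u) p := by
    rw [funext (liouvilleY_eq hpos h u), liouvilleX_sub a h ((contDiff_ofReal_snd hb).mul h₁) h₂,
      liouvilleX_snd_mul a h (fun t => (b t : ℂ))]
  have hYX : liouvilleY b h (liouvilleX a h u) p =
      (a p.1 : ℂ) * liouvilleY b h (LiouvilleQ1 a b h u) p +
        liouvilleY b h (LiouvilleQ2 a b h u) p := by
    have hQ : LiouvilleQ2 a b h u =
        fun q => liouvilleX a h u q - (a q.1 : ℂ) * LiouvilleQ1 a b h u q := by
      funext q
      rw [liouvilleX_eq hpos h u q]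
      ring
    have hX : ContDiff ℝ ∞ (liouvilleX a h u) :=
      (contDiff_const.mul (contDiff_dxx hu)).sub (((contDiff_ofReal_fst ha).pow 2).mul hu)
    rw [hQ, liouvilleY_sub b h hX ((contDiff_ofReal_fst ha).mul h₁),
      liouvilleY_fst_mul b h (fun s => (a s : ℂ))]
    ring
  have key := liouvilleX_liouvilleY_comm ha hb h hu p
  rw [hXY, hYX, liouvilleX_eq hpos, liouvilleX_eq hpos, liouvilleY_eq hpos,
    liouvilleY_eq hpos] at key
  refine mul_left_cancel₀ hc ?_
  linear_combination -key
end
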